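/- arXiv:2308.00213 — 11 statements merged into one kernel-verified Lean document; each statement's English description precedes it below -/
import Mathlib

section
/- In the tPCG recursion, if for every index i ≤ k one has ⟨H d⁽ⁱ⁾, d⁽ⁱ⁾⟩ > ε δ⁽ⁱ⁾ and r⁽ⁱ⁾ ≠ 0, then the search directions are H-conjugate: ⟨H d⁽ⁱ⁾, d⁽ʲ⁾⟩ = 0 for all i ≠ j with 0 ≤ i, j ≤ k. -/
open scoped RealInnerProductSpace

/-- Preconditioned conjugate gradient directions are conjugate as long as neither the
preconditioned residual products nor the curvatures vanish. -/
theorem pcg_residual_orthogonal_and_conjugate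
    {E : Type*} [NormedAddCommGroup E] [InnerProductSpace ℝ E]
    (H : E →ₗ[ℝ] E) (hH : LinearMap.IsSymmetric H)
    (r y d : ℕ → E) (α β : ℕ → ℝ)
    (hsym : ∀ i j, ⟪r i, y j⟫ = ⟪r j, y i⟫)
    (hd0 : d 0 = y 0)
    (hα : ∀ i, α i = ⟪r i, y i⟫ / ⟪d i, H (d i)⟫)
    (hrs : ∀ i, r (i + 1) = r i - α i • H (d i))
    (hβ : ∀ i, β (i + 1) = ⟪r (i + 1), y (i + 1)⟫ / ⟪r i, y i⟫)
    (hds : ∀ i, d (i + 1) = y (i + 1) + β (i + 1) • d i)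
    (k : ℕ) (hc : ∀ i ≤ k, ⟪d i, H (d i)⟫ ≠ 0) (hρ : ∀ i ≤ k, ⟪r i, y i⟫ ≠ 0) :
    ∀ n ≤ k, ∀ j < n, ⟪r n, y j⟫ = 0 ∧ ⟪d n, H (d j)⟫ = 0 := by
  intro n
  induction n with
  | zero => intro _ j hj; omega
  | succ n ih =>
    intro hn
    have ih := ih (by omega)
    have hcn := hc n (by omega)
    have hρn := hρ n (by omega)
    have hconj_comm : ∀ i j, ⟪H (d i), d j⟫ = ⟪d i, H (d j)⟫ := fun i j => hH (d i) (d j)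
    have hHy : ∀ j ≤ n, ⟪H (d n), y j⟫ = ⟪d n, H (d j)⟫ := by
      rintro (_ | j) hj
      · rw [← hd0, hconj_comm]
      · have hy : y (j + 1) = d (j + 1) - β (j + 1) • d j := by rw [hds j]; abel
        rw [hy, inner_sub_right, inner_smul_right, hconj_comm, hconj_comm,
          (ih j (by omega)).2, mul_zero, sub_zero]
    have hr : ∀ j ≤ n, ⟪r (n + 1), y j⟫ = 0 := by
      intro j hj
      rw [hrs, inner_sub_left, real_inner_smul_left, hHy j hj]
      rcases hj.lt_or_eq with hlt | rfl
      · rw [(ih j hlt).1, (ih j hlt).2, mul_zero, sub_zero]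
      · rw [hα, div_mul_cancel₀ _ hcn, sub_self]
    intro j hj
    refine ⟨hr j (by omega), ?_⟩
    have hαj : α j ≠ 0 := by
      rw [hα]
      exact div_ne_zero (hρ j (by omega)) (hc j (by omega))
    have hstep : α j * ⟪y (n + 1), H (d j)⟫ = -⟪r (j + 1), y (n + 1)⟫ := by
      have h : ⟪r (j + 1), y (n + 1)⟫
          = ⟪r j, y (n + 1)⟫ - α j * ⟪H (d j), y (n + 1)⟫ := by
        rw [hrs, inner_sub_left, real_inner_smul_left]
      rw [hsym j, hr j (by omega), real_inner_comm (y (n + 1)) (H (d j))] at h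
      linarith
    rw [hds, inner_add_left, real_inner_smul_left]
    rcases (Nat.lt_succ_iff.mp hj).lt_or_eq with hlt | rfl
    · rw [hsym, hr (j + 1) hlt, neg_zero] at hstep
      rw [(mul_eq_zero.mp hstep).resolve_left hαj, (ih j hlt).2, mul_zero, add_zero]
    · rw [hα] at hstep
      rw [hβ]
      field_simp at hstep ⊢
      linarith

/-- In the tPCG recursion, if for every index `i ≤ k` one has
`⟪H d i, d i⟫ > ε * δ i` and `r i ≠ 0`, then the search directions are
`H`-conjugate: `⟪H (d i), d j⟫ = 0` for all `i ≠ j` with `i, j ≤ k`. -/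
theorem tPCG_directions_H_conjugate
    {E : Type*} [NormedAddCommGroup E] [InnerProductSpace ℝ E] [FiniteDimensional ℝ E]
    (H : E →ₗ[ℝ] E) (hH : LinearMap.IsSymmetric H)
    (P : E ≃ₗ[ℝ] E) (hPsym : LinearMap.IsSymmetric (P : E →ₗ[ℝ] E))
    (hPpos : ∀ v : E, v ≠ 0 → 0 < ⟪(P : E →ₗ[ℝ] E) v, v⟫)
    (g : E) (ε : ℝ) (hε : 0 < ε)
    (η r y d : ℕ → E) (δ α β : ℕ → ℝ)
    (hη0 : η 0 = 0) (hr0 : r 0 = -g) (hy0 : y 0 = P.symm (r 0))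
    (hd0 : d 0 = y 0) (hδ0 : δ 0 = ⟪y 0, y 0⟫)
    (hα : ∀ i, α i = ⟪r i, y i⟫ / ⟪d i, H (d i)⟫)
    (hηs : ∀ i, η (i + 1) = η i + α i • d i)
    (hrs : ∀ i, r (i + 1) = r i - α i • H (d i))
    (hys : ∀ i, y (i + 1) = P.symm (r (i + 1)))
    (hβ : ∀ i, β (i + 1) = ⟪r (i + 1), y (i + 1)⟫ / ⟪r i, y i⟫)
    (hds : ∀ i, d (i + 1) = y (i + 1) + β (i + 1) • d i)
    (hδs : ∀ i, δ (i + 1) = ⟪y (i + 1), y (i + 1)⟫ + (β (i + 1)) ^ 2 * δ i)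
    (k : ℕ)
    (hcurv : ∀ i ≤ k, ε * δ i < ⟪H (d i), d i⟫)
    (hrne : ∀ i ≤ k, r i ≠ 0) :
    ∀ i ≤ k, ∀ j ≤ k, i ≠ j → ⟪H (d i), d j⟫ = 0 := by
  have hy : ∀ i, y i = P.symm (r i) := fun i => by cases i <;> simp only [hy0, hys]
  have hPy : ∀ i, P (y i) = r i := fun i => by rw [hy, P.apply_symm_apply]
  have hδ : ∀ i, 0 ≤ δ i := by
    intro i
    induction i with
    | zero => rw [hδ0]; exact real_inner_self_nonneg
    | succ i ih =>
      rw [hδs]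
      exact add_nonneg real_inner_self_nonneg (mul_nonneg (sq_nonneg _) ih)
  have hsym : ∀ i j, ⟪r i, y j⟫ = ⟪r j, y i⟫ := by
    intro i j
    rw [← hPy i, ← hPy j, real_inner_comm (y i)]
    exact hPsym (y i) (y j)
  have hc : ∀ i ≤ k, ⟪d i, H (d i)⟫ ≠ 0 := by
    intro i hi
    rw [real_inner_comm]
    exact ((mul_nonneg hε.le (hδ i)).trans_lt (hcurv i hi)).ne'
  have hρ : ∀ i ≤ k, ⟪r i, y i⟫ ≠ 0 := by
    intro i hi
    have hyi : y i ≠ 0 := by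
      intro h
      exact hrne i hi (by rw [← hPy, h, map_zero])
    rw [← hPy i]
    exact (hPpos (y i) hyi).ne'
  have main := pcg_residual_orthogonal_and_conjugate H hH r y d α β hsym hd0 hα hrs hβ hds k hc hρ
  intro i hi j hj hij
  rcases hij.lt_or_gt with h | h
  · rw [real_inner_comm]
    exact (main j hj i h).2
  · rw [hH]
    exact (main i hi j h).2
end

section
/- In the tPCG recursion, if for every index i ≤ k one has ⟨H d⁽ⁱ⁾, d⁽ⁱ⁾⟩ > ε δ⁽ⁱ⁾ and r⁽ⁱ⁾ ≠ 0, then the residuals are orthogonal to the earlier search directions: ⟨d⁽ⁱ⁾, r⁽ʲ⁾⟩ = 0 for all 0 ≤ i < j ≤ k + 1. -/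
open scoped RealInnerProductSpace

/-- In the conjugate gradient recursion preconditioned by a symmetric operator `Q`, as long as
no step breaks down, the residuals are orthogonal to the earlier search directions and the search
directions are mutually `H`-conjugate. -/
theorem preconditionedCG_orthogonal_and_conjugate
    {E : Type*} [NormedAddCommGroup E] [InnerProductSpace ℝ E]
    {H Q : E →ₗ[ℝ] E} (hH : H.IsSymmetric) (hQ : Q.IsSymmetric)
    {r d : ℕ → E} {α β : ℕ → ℝ} (hd0 : d 0 = Q (r 0))
    (hα : ∀ i, α i = ⟪r i, Q (r i)⟫ / ⟪d i, H (d i)⟫)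
    (hrs : ∀ i, r (i + 1) = r i - α i • H (d i))
    (hβ : ∀ i, β (i + 1) = ⟪r (i + 1), Q (r (i + 1))⟫ / ⟪r i, Q (r i)⟫)
    (hds : ∀ i, d (i + 1) = Q (r (i + 1)) + β (i + 1) • d i)
    {m : ℕ} (hdH : ∀ i < m, ⟪d i, H (d i)⟫ ≠ 0) (hrQ : ∀ i < m, ⟪r i, Q (r i)⟫ ≠ 0) :
    ∀ n ≤ m, ∀ i < n, ⟪d i, r n⟫ = 0 ∧ ⟪H (d i), d n⟫ = 0 := by
  intro n
  induction n with
  | zero => intro _ i hi; omega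
  | succ n ih =>
    intro hn
    have ih := ih (by omega)
    have hdHn := hdH n hn
    have hrQn := hrQ n hn
    have hdr : ⟪d n, r n⟫ = ⟪r n, Q (r n)⟫ := by
      cases n with
      | zero => rw [hd0, real_inner_comm]
      | succ l =>
        rw [hds l, inner_add_left, real_inner_smul_left, (ih l (by omega)).1, real_inner_comm]
        ring
    have hαn : α n * ⟪d n, H (d n)⟫ = ⟪r n, Q (r n)⟫ := by
      rw [hα n, div_mul_cancel₀ _ hdHn]
    have orth : ∀ i < n + 1, ⟪d i, r (n + 1)⟫ = 0 := by
      intro i hi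
      rw [hrs n, inner_sub_right, real_inner_smul_right]
      rcases Nat.lt_succ_iff_lt_or_eq.mp hi with h | rfl
      · rw [(ih i h).1, ← hH, (ih i h).2]
        ring
      · rw [hdr, hαn, sub_self]
    have orthQ : ∀ i < n + 1, ⟪r i, Q (r (n + 1))⟫ = 0 := by
      intro i hi
      rw [← hQ]
      cases i with
      | zero => rw [← hd0, orth 0 hi]
      | succ l =>
        rw [eq_sub_of_add_eq (hds l).symm, inner_sub_left, real_inner_smul_left, orth _ hi,
          orth l (by omega)]
        ring
    refine fun i hi => ⟨orth i hi, ?_⟩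
    have hαi : α i ≠ 0 := by
      rw [hα i]
      exact div_ne_zero (hrQ i (by omega)) (hdH i (by omega))
    have hstep : α i * ⟪H (d i), Q (r (n + 1))⟫ = -⟪r (i + 1), Q (r (n + 1))⟫ := by
      rw [hrs i, inner_sub_left, real_inner_smul_left, orthQ i hi]
      ring
    apply (mul_eq_zero.mp _).resolve_left hαi
    rw [hds n, inner_add_right, real_inner_smul_right, mul_add, hstep]
    rcases Nat.lt_succ_iff_lt_or_eq.mp hi with h | rfl
    · rw [orthQ (i + 1) (by omega), (ih i h).2]
      ring
    · have hβi : β (i + 1) * ⟪r i, Q (r i)⟫ = ⟪r (i + 1), Q (r (i + 1))⟫ := by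
        rw [hβ i, div_mul_cancel₀ _ hrQn]
      rw [real_inner_comm (d i) (H (d i))]
      linear_combination β (i + 1) * hαn + hβi

/-- In the tPCG recursion, if for every index `i ≤ k` one has
`⟪H d i, d i⟫ > ε * δ i` and `r i ≠ 0`, then the residuals are orthogonal to the
earlier search directions: `⟪d i, r j⟫ = 0` for all `0 ≤ i < j ≤ k + 1`. -/
theorem tPCG_residual_orthogonal_directions
    {E : Type*} [NormedAddCommGroup E] [InnerProductSpace ℝ E] [FiniteDimensional ℝ E]
    (H : E →ₗ[ℝ] E) (hH : LinearMap.IsSymmetric H)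
    (P : E ≃ₗ[ℝ] E) (hPsym : LinearMap.IsSymmetric (P : E →ₗ[ℝ] E))
    (hPpos : ∀ v : E, v ≠ 0 → 0 < ⟪(P : E →ₗ[ℝ] E) v, v⟫)
    (g : E) (ε : ℝ) (hε : 0 < ε)
    (η r y d : ℕ → E) (δ α β : ℕ → ℝ)
    (hη0 : η 0 = 0) (hr0 : r 0 = -g) (hy0 : y 0 = P.symm (r 0))
    (hd0 : d 0 = y 0) (hδ0 : δ 0 = ⟪y 0, y 0⟫)
    (hα : ∀ i, α i = ⟪r i, y i⟫ / ⟪d i, H (d i)⟫)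
    (hηs : ∀ i, η (i + 1) = η i + α i • d i)
    (hrs : ∀ i, r (i + 1) = r i - α i • H (d i))
    (hys : ∀ i, y (i + 1) = P.symm (r (i + 1)))
    (hβ : ∀ i, β (i + 1) = ⟪r (i + 1), y (i + 1)⟫ / ⟪r i, y i⟫)
    (hds : ∀ i, d (i + 1) = y (i + 1) + β (i + 1) • d i)
    (hδs : ∀ i, δ (i + 1) = ⟪y (i + 1), y (i + 1)⟫ + (β (i + 1)) ^ 2 * δ i)
    (k : ℕ)
    (hcurv : ∀ i ≤ k, ε * δ i < ⟪H (d i), d i⟫)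
    (hrne : ∀ i ≤ k, r i ≠ 0) :
    ∀ i j, i < j → j ≤ k + 1 → ⟪d i, r j⟫ = 0 := by
  have hy : ∀ i, y i = (P.symm : E →ₗ[ℝ] E) (r i) := by
    rintro (_ | i)
    exacts [hy0, hys i]
  have hQ : (P.symm : E →ₗ[ℝ] E).IsSymmetric := by
    intro u v
    simpa using (hPsym (P.symm u) (P.symm v)).symm
  have hδ : ∀ i, 0 ≤ δ i := by
    intro i
    induction i with
    | zero => rw [hδ0]; exact real_inner_self_nonneg
    | succ i ih =>
      rw [hδs i]
      exact add_nonneg real_inner_self_nonneg (mul_nonneg (sq_nonneg _) ih)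
  simp only [hy] at hα hβ hds hd0
  have key := preconditionedCG_orthogonal_and_conjugate hH hQ hd0 hα hrs hβ hds (m := k + 1)
    (fun i hi => by
      rw [← hH]
      exact ((mul_nonneg hε.le (hδ i)).trans_lt (hcurv i (by omega))).ne')
    (fun i hi => by
      have h := hPpos (P.symm (r i)) (by simpa using hrne i (by omega))
      simpa using h.ne')
  exact fun i j hij hj => (key j hj i hij).1
end

section
/- In the tPCG recursion, if for every index i ≤ k one has ⟨H d⁽ⁱ⁾, d⁽ⁱ⁾⟩ > ε δ⁽ⁱ⁾ and r⁽ⁱ⁾ ≠ 0, then for all 0 ≤ i ≤ j ≤ k one has the invariance ⟨r⁽ⁱ⁾, d⁽ʲ⁾⟩ = ⟨r⁽ʲ⁾, y⁽ʲ⁾⟩ = ⟨r⁽⁰⁾, d⁽ʲ⁾⟩. -/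
open scoped RealInnerProductSpace

section ConjugateDirections

variable {E : Type*} [NormedAddCommGroup E] [InnerProductSpace ℝ E]
  {H : E →ₗ[ℝ] E} {r y d : ℕ → E} {α β : ℕ → ℝ}

/-- A residual orthogonal to all previous search directions satisfies `⟪r n, d n⟫ = ⟪r n, y n⟫`. -/
lemma inner_residual_direction (hd0 : d 0 = y 0)
    (hds : ∀ i, d (i + 1) = y (i + 1) + β (i + 1) • d i) {n : ℕ}
    (h : ∀ i < n, ⟪r n, d i⟫ = 0) : ⟪r n, d n⟫ = ⟪r n, y n⟫ := by
  cases n with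
  | zero => rw [hd0]
  | succ m => rw [hds, inner_add_right, inner_smul_right, h m m.lt_succ_self, mul_zero, add_zero]

/-- A vector orthogonal to the first search directions is orthogonal to the preconditioned
residuals from which they are built. -/
lemma inner_preconditioned_eq_zero (hd0 : d 0 = y 0)
    (hds : ∀ i, d (i + 1) = y (i + 1) + β (i + 1) • d i) {v : E} {n : ℕ}
    (h : ∀ i < n, ⟪v, d i⟫ = 0) : ∀ i < n, ⟪v, y i⟫ = 0 := by
  intro i hi
  cases i with
  | zero => rw [← hd0, h 0 hi]
  | succ m =>
    have := h (m + 1) hi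
    rwa [hds, inner_add_right, inner_smul_right, h m (by lia), mul_zero, add_zero] at this

/-- In the preconditioned conjugate gradient recursion, as long as it does not break down, the
residuals are orthogonal to the previous search directions and the search directions are
`H`-conjugate. -/
lemma residual_orthogonal_and_conjugate (hH : H.IsSymmetric)
    (hy : ∀ i j, ⟪r i, y j⟫ = ⟪r j, y i⟫) (hd0 : d 0 = y 0)
    (hα : ∀ i, α i = ⟪r i, y i⟫ / ⟪d i, H (d i)⟫)
    (hrs : ∀ i, r (i + 1) = r i - α i • H (d i))
    (hβ : ∀ i, β (i + 1) = ⟪r (i + 1), y (i + 1)⟫ / ⟪r i, y i⟫)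
    (hds : ∀ i, d (i + 1) = y (i + 1) + β (i + 1) • d i) {k : ℕ}
    (hcurv : ∀ i ≤ k, ⟪d i, H (d i)⟫ ≠ 0) (hres : ∀ i ≤ k, ⟪r i, y i⟫ ≠ 0) :
    ∀ n ≤ k, ∀ i < n, ⟪r n, d i⟫ = 0 ∧ ⟪d n, H (d i)⟫ = 0 := by
  intro n
  induction n with
  | zero => intro _ i hi; exact absurd hi i.not_lt_zero
  | succ n ih =>
    intro hn
    have ih := ih (by lia)
    have hc := hcurv n (by lia)
    have hαn : α n * ⟪d n, H (d n)⟫ = ⟪r n, y n⟫ := by rw [hα, div_mul_cancel₀ _ hc]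
    have hβn : β (n + 1) * ⟪r n, y n⟫ = ⟪r (n + 1), y (n + 1)⟫ := by
      rw [hβ, div_mul_cancel₀ _ (hres n (by lia))]
    have hrd : ∀ i < n + 1, ⟪r (n + 1), d i⟫ = 0 := by
      intro i hi
      rw [hrs, inner_sub_left, real_inner_smul_left, hH (d n) (d i)]
      obtain hi | rfl := Nat.lt_succ_iff_lt_or_eq.mp hi
      · rw [(ih i hi).1, (ih i hi).2, mul_zero, sub_zero]
      · rw [inner_residual_direction hd0 hds fun j hj => (ih j hj).1, hαn, sub_self]
    have hry := inner_preconditioned_eq_zero hd0 hds hrd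
    refine fun i hi => ⟨hrd i hi, ?_⟩
    have hαi : α i ≠ 0 := by
      rw [hα]
      exact div_ne_zero (hres i (by lia)) (hcurv i (by lia))
    have hyH : α i * ⟪y (n + 1), H (d i)⟫ = -⟪r (i + 1), y (n + 1)⟫ := by
      have h := congrArg (fun v => ⟪v, y (n + 1)⟫) (hrs i)
      simp only [inner_sub_left, real_inner_smul_left] at h
      rw [hy i, hry i hi, real_inner_comm (y (n + 1)) (H (d i))] at h
      linarith
    refine (mul_eq_zero.mp ?_).resolve_left hαi
    rw [hds, inner_add_left, real_inner_smul_left, mul_add, hyH]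
    obtain hi | rfl := Nat.lt_succ_iff_lt_or_eq.mp hi
    · rw [hy, hry (i + 1) (by lia), (ih i hi).2]
      ring
    · rw [← hβn, ← hαn]
      ring

end ConjugateDirections

/-- In the tPCG recursion, if for every index `i ≤ k` one has
`⟪H d i, d i⟫ > ε * δ i` and `r i ≠ 0`, then for all `0 ≤ i ≤ j ≤ k` one has the
invariance `⟪r i, d j⟫ = ⟪r j, y j⟫ = ⟪r 0, d j⟫`. -/
theorem tPCG_inner_product_invariance
    {E : Type*} [NormedAddCommGroup E] [InnerProductSpace ℝ E] [FiniteDimensional ℝ E]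
    (H : E →ₗ[ℝ] E) (hH : LinearMap.IsSymmetric H)
    (P : E ≃ₗ[ℝ] E) (hPsym : LinearMap.IsSymmetric (P : E →ₗ[ℝ] E))
    (hPpos : ∀ v : E, v ≠ 0 → 0 < ⟪(P : E →ₗ[ℝ] E) v, v⟫)
    (g : E) (ε : ℝ) (hε : 0 < ε)
    (η r y d : ℕ → E) (δ α β : ℕ → ℝ)
    (hη0 : η 0 = 0) (hr0 : r 0 = -g) (hy0 : y 0 = P.symm (r 0))
    (hd0 : d 0 = y 0) (hδ0 : δ 0 = ⟪y 0, y 0⟫)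
    (hα : ∀ i, α i = ⟪r i, y i⟫ / ⟪d i, H (d i)⟫)
    (hηs : ∀ i, η (i + 1) = η i + α i • d i)
    (hrs : ∀ i, r (i + 1) = r i - α i • H (d i))
    (hys : ∀ i, y (i + 1) = P.symm (r (i + 1)))
    (hβ : ∀ i, β (i + 1) = ⟪r (i + 1), y (i + 1)⟫ / ⟪r i, y i⟫)
    (hds : ∀ i, d (i + 1) = y (i + 1) + β (i + 1) • d i)
    (hδs : ∀ i, δ (i + 1) = ⟪y (i + 1), y (i + 1)⟫ + (β (i + 1)) ^ 2 * δ i)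
    (k : ℕ)
    (hcurv : ∀ i ≤ k, ε * δ i < ⟪H (d i), d i⟫)
    (hrne : ∀ i ≤ k, r i ≠ 0) :
    ∀ i j, i ≤ j → j ≤ k →
      ⟪r i, d j⟫ = ⟪r j, y j⟫ ∧ ⟪r j, y j⟫ = ⟪r 0, d j⟫ := by
  have hyP : ∀ i, r i = P (y i) := by
    intro i
    cases i with
    | zero => rw [hy0, P.apply_symm_apply]
    | succ i => rw [hys, P.apply_symm_apply]
  have hy : ∀ i j, ⟪r i, y j⟫ = ⟪r j, y i⟫ := by
    intro i j
    rw [hyP i, hyP j, real_inner_comm (y i)]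
    exact hPsym (y i) (y j)
  have hδ : ∀ i, 0 ≤ δ i := by
    intro i
    induction i with
    | zero => rw [hδ0]; exact real_inner_self_nonneg
    | succ i ih =>
      rw [hδs]
      exact add_nonneg real_inner_self_nonneg (mul_nonneg (sq_nonneg _) ih)
  have hc : ∀ i ≤ k, ⟪d i, H (d i)⟫ ≠ 0 := by
    intro i hi
    rw [real_inner_comm]
    exact ((mul_nonneg hε.le (hδ i)).trans_lt (hcurv i hi)).ne'
  have hres : ∀ i ≤ k, ⟪r i, y i⟫ ≠ 0 := by
    intro i hi
    have hyi : y i ≠ 0 := fun h => hrne i hi (by rw [hyP, h, map_zero])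
    rw [hyP]
    exact (hPpos (y i) hyi).ne'
  have horth := residual_orthogonal_and_conjugate hH hy hd0 hα hrs hβ hds hc hres
  intro i j hij hjk
  have hconst : ∀ i ≤ j, ⟪r i, d j⟫ = ⟪r 0, d j⟫ := by
    intro i
    induction i with
    | zero => intro _; rfl
    | succ i ih =>
      intro hi
      rw [hrs, inner_sub_left, real_inner_smul_left, real_inner_comm (d j) (H (d i)),
        (horth j hjk i hi).2, mul_zero, sub_zero, ih (by lia)]
  have hjj := inner_residual_direction hd0 hds fun i hi => (horth j hjk i hi).1
  rw [← hjj, hconst i hij, hconst j le_rfl]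
  exact ⟨rfl, rfl⟩
end

section
/- In the tPCG recursion, suppose g ≠ 0, H ≠ 0, the preconditioner satisfies p₁‖v‖² ≤ ⟨P v, v⟩ ≤ p₂‖v‖² for all v ∈ E with constants 0 < p₁ ≤ p₂, and for some i ≥ 1 every index j ≤ i − 1 satisfies ⟨H d⁽ʲ⁾, d⁽ʲ⁾⟩ > ε δ⁽ʲ⁾ and r⁽ʲ⁾ ≠ 0. Then the tPCG output η⁽ⁱ⁾ is a sufficient descent direction: ⟨g, η⁽ⁱ⁾⟩ ≤ −(p₁ / (p₂ ‖H‖)) ‖g‖², where ‖H‖ is the operator norm of H. -/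
open scoped RealInnerProductSpace

section

variable {E : Type*} [NormedAddCommGroup E] [InnerProductSpace ℝ E]

/-- In the preconditioned conjugate gradient recursion, as long as no breakdown occurs, every
residual is orthogonal to all earlier search directions and the search directions are pairwise
`H`-conjugate. -/
theorem pcg_orthogonality (H : E →L[ℝ] E) (hH : LinearMap.IsSymmetric (H : E →ₗ[ℝ] E))
    (B : E →ₗ[ℝ] E) (hB : B.IsSymmetric) (r y d : ℕ → E) (α β : ℕ → ℝ)
    (hd0 : d 0 = y 0) (hy : ∀ i, y i = B (r i))
    (hα : ∀ i, α i = ⟪r i, y i⟫ / ⟪d i, H (d i)⟫)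
    (hrs : ∀ i, r (i + 1) = r i - α i • H (d i))
    (hβ : ∀ i, β (i + 1) = ⟪r (i + 1), y (i + 1)⟫ / ⟪r i, y i⟫)
    (hds : ∀ i, d (i + 1) = y (i + 1) + β (i + 1) • d i)
    (n : ℕ) (hc : ∀ j < n, ⟪d j, H (d j)⟫ ≠ 0) (hρ : ∀ j < n, ⟪r j, y j⟫ ≠ 0) :
    ∀ j ≤ n, ∀ k < j, ⟪r j, d k⟫ = 0 ∧ ⟪d j, H (d k)⟫ = 0 := by
  intro j
  induction j with
  | zero => intro _ k hk; omega
  | succ j ih =>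
    intro hj
    have ih := ih (by omega)
    have hcj := hc j (by omega)
    have hρj := hρ j (by omega)
    have hrd : ⟪r j, d j⟫ = ⟪r j, y j⟫ := by
      cases j with
      | zero => rw [hd0]
      | succ m => rw [hds, inner_add_right, inner_smul_right, (ih m (by omega)).1]; ring
    have hr : ∀ k < j + 1, ⟪r (j + 1), d k⟫ = 0 := by
      intro k hk
      rw [hrs, inner_sub_left, real_inner_smul_left]
      rcases Nat.lt_succ_iff_lt_or_eq.mp hk with h | rfl
      · have hs : ⟪H (d j), d k⟫ = ⟪d j, H (d k)⟫ := hH _ _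
        rw [hs, (ih k h).1, (ih k h).2]; ring
      · rw [hrd, real_inner_comm (d k) (H (d k)), hα, div_mul_cancel₀ _ hcj, sub_self]
    have hry : ∀ k < j + 1, ⟪r (j + 1), y k⟫ = 0 := by
      intro k hk
      cases k with
      | zero => rw [← hd0]; exact hr 0 hk
      | succ m =>
        rw [eq_sub_of_add_eq (hds m).symm, inner_sub_right, inner_smul_right, hr _ hk,
          hr m (by omega)]
        ring
    refine fun k hk => ⟨hr k hk, ?_⟩
    have hαk : α k ≠ 0 := by
      rw [hα]; exact div_ne_zero (hρ k (by omega)) (hc k (by omega))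
    have hsymm : α k * ⟪y (j + 1), H (d k)⟫ = ⟪r (j + 1), y k⟫ - ⟪r (j + 1), y (k + 1)⟫ := by
      have hHd : α k • H (d k) = r k - r (k + 1) := by rw [hrs]; abel
      rw [← inner_smul_right, hHd, hy (j + 1), hB, map_sub, inner_sub_right, ← hy, ← hy]
    refine (mul_eq_zero.mp ?_).resolve_left hαk
    rw [hds, inner_add_left, real_inner_smul_left, mul_add, hsymm, hry k hk]
    rcases Nat.lt_succ_iff_lt_or_eq.mp hk with h | rfl
    · rw [hry (k + 1) (by omega), (ih k h).2]; ring
    · rw [hβ, hα]; field_simp; ring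

/-- The initial residual has the same inner product with a search direction as the residual
belonging to that direction. -/
theorem pcg_inner_initial_residual (H : E →L[ℝ] E) (r d : ℕ → E) (α : ℕ → ℝ)
    (hrs : ∀ i, r (i + 1) = r i - α i • H (d i))
    (j : ℕ) (hconj : ∀ k < j, ⟪d j, H (d k)⟫ = 0) : ⟪r 0, d j⟫ = ⟪r j, d j⟫ := by
  suffices h : ∀ m ≤ j, ⟪r 0, d j⟫ = ⟪r m, d j⟫ from h j le_rfl
  intro m
  induction m with
  | zero => intro _; rfl
  | succ m ih =>
    intro hm
    rw [ih (by omega), hrs, inner_sub_left, real_inner_smul_left, real_inner_comm (d j) (H (d m)),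
      hconj m (by omega)]
    ring

/-- An upper bound on the quadratic form of a positive operator gives a lower bound on the
quadratic form of its inverse. -/
theorem norm_sq_le_mul_inner_symm (P : E ≃ₗ[ℝ] E)
    (hPsym : LinearMap.IsSymmetric (P : E →ₗ[ℝ] E)) (hPnonneg : ∀ v, 0 ≤ ⟪P v, v⟫)
    {p : ℝ} (hp : 0 < p) (hPle : ∀ v, ⟪P v, v⟫ ≤ p * ‖v‖ ^ 2) (v : E) :
    ‖v‖ ^ 2 ≤ p * ⟪v, P.symm v⟫ := by
  have hs : ⟪P v, P.symm v⟫ = ‖v‖ ^ 2 := by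
    have h : ⟪P v, P.symm v⟫ = ⟪v, P (P.symm v)⟫ := hPsym _ _
    rw [h, P.apply_symm_apply, real_inner_self_eq_norm_sq]
  have h := hPnonneg (v - p • P.symm v)
  rw [map_sub, map_smul, P.apply_symm_apply, inner_sub_left, inner_sub_right, inner_sub_right,
    real_inner_smul_left, real_inner_smul_left, inner_smul_right, inner_smul_right, hs,
    real_inner_self_eq_norm_sq] at h
  have := hPle v
  exact le_of_mul_le_mul_left (by nlinarith) hp

/-- The first preconditioned steepest descent step already achieves the sufficient decrease. -/
theorem div_mul_norm_sq_le_inner_sq_div (H : E →L[ℝ] E) (P : E ≃ₗ[ℝ] E)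
    (hPsym : LinearMap.IsSymmetric (P : E →ₗ[ℝ] E)) {p₁ p₂ : ℝ} (hp₁ : 0 < p₁) (hp₂ : 0 < p₂)
    (hPge : ∀ v, p₁ * ‖v‖ ^ 2 ≤ ⟪P v, v⟫) (hPle : ∀ v, ⟪P v, v⟫ ≤ p₂ * ‖v‖ ^ 2)
    (v : E) (hc : 0 < ⟪P.symm v, H (P.symm v)⟫) :
    p₁ / (p₂ * ‖H‖) * ‖v‖ ^ 2 ≤ ⟪v, P.symm v⟫ ^ 2 / ⟪P.symm v, H (P.symm v)⟫ := by
  have hinv := norm_sq_le_mul_inner_symm P hPsym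
    (fun v => (by positivity : 0 ≤ p₁ * ‖v‖ ^ 2).trans (hPge v)) hp₂ hPle v
  have hlow := hPge (P.symm v)
  rw [P.apply_symm_apply] at hlow
  set z := P.symm v
  have hcle : ⟪z, H z⟫ ≤ ‖H‖ * ‖z‖ ^ 2 := by
    calc ⟪z, H z⟫ ≤ ‖z‖ * ‖H z‖ := real_inner_le_norm _ _
      _ ≤ ‖z‖ * (‖H‖ * ‖z‖) := by gcongr; exact H.le_opNorm z
      _ = ‖H‖ * ‖z‖ ^ 2 := by ring
  have hHpos : 0 < ‖H‖ := by
    by_contra h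
    have h0 : ‖H‖ = 0 := le_antisymm (not_lt.mp h) (norm_nonneg H)
    rw [h0, zero_mul] at hcle
    linarith
  have hvz : 0 ≤ ⟪v, z⟫ := (by positivity : 0 ≤ p₁ * ‖z‖ ^ 2).trans hlow
  rw [div_mul_eq_mul_div, div_le_div_iff₀ (by positivity) hc]
  calc p₁ * ‖v‖ ^ 2 * ⟪z, H z⟫ ≤ p₁ * (p₂ * ⟪v, z⟫) * (‖H‖ * ‖z‖ ^ 2) := by gcongr
    _ = p₂ * ⟪v, z⟫ * ‖H‖ * (p₁ * ‖z‖ ^ 2) := by ring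
    _ ≤ p₂ * ⟪v, z⟫ * ‖H‖ * ⟪v, z⟫ := by gcongr
    _ = ⟪v, z⟫ ^ 2 * (p₂ * ‖H‖) := by ring

end

/-- In the tPCG recursion, suppose `g ≠ 0`, `H ≠ 0`, the preconditioner satisfies
`p₁ * ‖v‖² ≤ ⟪P v, v⟫ ≤ p₂ * ‖v‖²` for all `v` with `0 < p₁ ≤ p₂`, and for some
`i ≥ 1` every index `j ≤ i - 1` satisfies `⟪H (d j), d j⟫ > ε * δ j` and `r j ≠ 0`.
Then the tPCG output `η i` is a sufficient descent direction:
`⟪g, η i⟫ ≤ -(p₁ / (p₂ * ‖H‖)) * ‖g‖²`. -/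
theorem tPCG_sufficient_descent
    {E : Type*} [NormedAddCommGroup E] [InnerProductSpace ℝ E] [FiniteDimensional ℝ E]
    (H : E →L[ℝ] E) (hH : LinearMap.IsSymmetric (H : E →ₗ[ℝ] E)) (hHne : H ≠ 0)
    (P : E ≃ₗ[ℝ] E) (hPsym : LinearMap.IsSymmetric (P : E →ₗ[ℝ] E))
    (p₁ p₂ : ℝ) (hp₁ : 0 < p₁) (hp₁₂ : p₁ ≤ p₂)
    (hPbound : ∀ v : E,
      p₁ * ‖v‖ ^ 2 ≤ ⟪(P : E →ₗ[ℝ] E) v, v⟫ ∧ ⟪(P : E →ₗ[ℝ] E) v, v⟫ ≤ p₂ * ‖v‖ ^ 2)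
    (g : E) (hg : g ≠ 0) (ε : ℝ) (hε : 0 < ε)
    (η r y d : ℕ → E) (δ α β : ℕ → ℝ)
    (hη0 : η 0 = 0) (hr0 : r 0 = -g) (hy0 : y 0 = P.symm (r 0))
    (hd0 : d 0 = y 0) (hδ0 : δ 0 = ⟪y 0, y 0⟫)
    (hα : ∀ i, α i = ⟪r i, y i⟫ / ⟪d i, H (d i)⟫)
    (hηs : ∀ i, η (i + 1) = η i + α i • d i)
    (hrs : ∀ i, r (i + 1) = r i - α i • H (d i))
    (hys : ∀ i, y (i + 1) = P.symm (r (i + 1)))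
    (hβ : ∀ i, β (i + 1) = ⟪r (i + 1), y (i + 1)⟫ / ⟪r i, y i⟫)
    (hds : ∀ i, d (i + 1) = y (i + 1) + β (i + 1) • d i)
    (hδs : ∀ i, δ (i + 1) = ⟪y (i + 1), y (i + 1)⟫ + (β (i + 1)) ^ 2 * δ i)
    (i : ℕ) (hi : 1 ≤ i)
    (hcurv : ∀ j ≤ i - 1, ε * δ j < ⟪H (d j), d j⟫)
    (hrne : ∀ j ≤ i - 1, r j ≠ 0) :
    ⟪g, η i⟫ ≤ -(p₁ / (p₂ * ‖H‖)) * ‖g‖ ^ 2 := by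
  have hp₂ : 0 < p₂ := hp₁.trans_le hp₁₂
  have hy : ∀ j, y j = (P.symm : E →ₗ[ℝ] E) (r j)
    | 0 => hy0
    | j + 1 => hys j
  have hPge : ∀ v, p₁ * ‖v‖ ^ 2 ≤ ⟪P v, v⟫ := fun v => (hPbound v).1
  have hPle : ∀ v, ⟪P v, v⟫ ≤ p₂ * ‖v‖ ^ 2 := fun v => (hPbound v).2
  have hsymm : LinearMap.IsSymmetric (P.symm : E →ₗ[ℝ] E) := by
    intro u v
    have h : ⟪P (P.symm u), P.symm v⟫ = ⟪P.symm u, P (P.symm v)⟫ := hPsym _ _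
    rw [P.apply_symm_apply, P.apply_symm_apply] at h
    exact h.symm
  have hδ : ∀ j, 0 ≤ δ j := by
    intro j
    induction j with
    | zero => rw [hδ0]; exact real_inner_self_nonneg
    | succ j ih => rw [hδs]; exact add_nonneg real_inner_self_nonneg (by positivity)
  have hc : ∀ j < i, 0 < ⟪d j, H (d j)⟫ := by
    intro j hj
    rw [real_inner_comm]
    exact (mul_nonneg hε.le (hδ j)).trans_lt (hcurv j (by omega))
  have hρ : ∀ j < i, 0 < ⟪r j, y j⟫ := by
    intro j hj
    have h := norm_sq_le_mul_inner_symm P hPsym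
      (fun v => (by positivity : 0 ≤ p₁ * ‖v‖ ^ 2).trans (hPge v)) hp₂ hPle (r j)
    have hr : 0 < ‖r j‖ := norm_pos_iff.mpr (hrne j (by omega))
    rw [hy]
    exact pos_of_mul_pos_right ((by positivity : 0 < ‖r j‖ ^ 2).trans_le h) hp₂.le
  have horth := pcg_orthogonality H hH (P.symm : E →ₗ[ℝ] E) hsymm r y d α β hd0 hy hα hrs hβ hds i
    (fun j hj => (hc j hj).ne') (fun j hj => (hρ j hj).ne')
  have hg_eq : g = -r 0 := by rw [hr0, neg_neg]
  have hstep : ∀ j < i, ⟪g, α j • d j⟫ = -(⟪r j, y j⟫ ^ 2 / ⟪d j, H (d j)⟫) := by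
    intro j hj
    have hrd : ⟪r j, d j⟫ = ⟪r j, y j⟫ := by
      cases j with
      | zero => rw [hd0]
      | succ m =>
        rw [hds, inner_add_right, inner_smul_right, (horth _ hj.le m (by omega)).1]; ring
    rw [hg_eq, inner_smul_right, inner_neg_left,
      pcg_inner_initial_residual H r d α hrs j (fun k hk => (horth j hj.le k hk).2), hrd, hα]
    ring
  have hfirst : ⟪g, η 1⟫ ≤ -(p₁ / (p₂ * ‖H‖)) * ‖g‖ ^ 2 := by
    have hd : d 0 = P.symm (r 0) := hd0.trans hy0
    have hc0 := hc 0 hi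
    rw [hd] at hc0
    have h := div_mul_norm_sq_le_inner_sq_div H P hPsym hp₁ hp₂ hPge hPle (r 0) hc0
    rw [hηs 0, hη0, zero_add, hstep 0 hi, hg_eq, norm_neg, hd, hy0, neg_mul]
    exact neg_le_neg h
  suffices h : ∀ j, 1 ≤ j → j ≤ i → ⟪g, η j⟫ ≤ -(p₁ / (p₂ * ‖H‖)) * ‖g‖ ^ 2 from h i hi le_rfl
  intro j hj
  induction j, hj using Nat.le_induction with
  | base => exact fun _ => hfirst
  | succ j _ ih =>
    intro hji
    have hdec : 0 ≤ ⟪r j, y j⟫ ^ 2 / ⟪d j, H (d j)⟫ := div_nonneg (sq_nonneg _) (hc j hji).le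
    rw [hηs, inner_add_right, hstep j hji]
    linarith [ih (by omega)]
end

section
/- In the tPCG recursion with identity preconditioner P = id (so y⁽ⁱ⁾ = r⁽ⁱ⁾), if for every index i ≤ k one has ⟨H d⁽ⁱ⁾, d⁽ⁱ⁾⟩ > ε δ⁽ⁱ⁾ and r⁽ⁱ⁾ ≠ 0, then (a) δ⁽ⁱ⁾ = ⟨d⁽ⁱ⁾, d⁽ⁱ⁾⟩ for every i ≤ k + 1, and (b) the iterates satisfy the norm bound ‖η⁽ⁱ⁾‖ ≤ (i / ε) ‖g‖ for every i ≤ k + 1. -/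
open scoped RealInnerProductSpace

/-- In the tPCG recursion with identity preconditioner `P = id` (so `y i = r i`),
if for every index `i ≤ k` one has `⟪H (d i), d i⟫ > ε * δ i` and `r i ≠ 0`, then
(a) `δ i = ⟪d i, d i⟫` for every `i ≤ k + 1`, and
(b) the iterates satisfy the norm bound `‖η i‖ ≤ (i / ε) * ‖g‖` for every `i ≤ k + 1`. -/
theorem tPCG_delta_eq_and_norm_bound
    {E : Type*} [NormedAddCommGroup E] [InnerProductSpace ℝ E] [FiniteDimensional ℝ E]
    (H : E →ₗ[ℝ] E) (hH : LinearMap.IsSymmetric H)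
    (g : E) (ε : ℝ) (hε : 0 < ε)
    (η r d : ℕ → E) (δ α β : ℕ → ℝ)
    (hη0 : η 0 = 0) (hr0 : r 0 = -g)
    (hd0 : d 0 = r 0) (hδ0 : δ 0 = ⟪r 0, r 0⟫)
    (hα : ∀ i, α i = ⟪r i, r i⟫ / ⟪d i, H (d i)⟫)
    (hηs : ∀ i, η (i + 1) = η i + α i • d i)
    (hrs : ∀ i, r (i + 1) = r i - α i • H (d i))
    (hβ : ∀ i, β (i + 1) = ⟪r (i + 1), r (i + 1)⟫ / ⟪r i, r i⟫)
    (hds : ∀ i, d (i + 1) = r (i + 1) + β (i + 1) • d i)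
    (hδs : ∀ i, δ (i + 1) = ⟪r (i + 1), r (i + 1)⟫ + (β (i + 1)) ^ 2 * δ i)
    (k : ℕ)
    (hcurv : ∀ i ≤ k, ε * δ i < ⟪H (d i), d i⟫)
    (hrne : ∀ i ≤ k, r i ≠ 0) :
    (∀ i ≤ k + 1, δ i = ⟪d i, d i⟫) ∧
    (∀ i ≤ k + 1, ‖η i‖ ≤ ((i : ℝ) / ε) * ‖g‖) := by
  have inv : ∀ i ≤ k + 1, ⟪r i, d i⟫ = ⟪r i, r i⟫ ∧ δ i = ⟪d i, d i⟫ ∧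
      ⟪r i, r i⟫ ^ 2 ≤ δ i * ⟪g, g⟫ := by
    intro i
    induction i with
    | zero =>
      intro _
      refine ⟨by rw [hd0], by rw [hδ0, hd0], le_of_eq ?_⟩
      rw [hδ0, hr0, inner_neg_neg, sq]
    | succ i ih =>
      intro hi
      obtain ⟨hrd, hδ, hG⟩ := ih (by omega)
      have hpos : 0 < ⟪d i, H (d i)⟫ := by
        rw [real_inner_comm]
        have h0 : 0 ≤ ε * δ i := by
          rw [hδ]
          exact mul_nonneg hε.le real_inner_self_nonneg
        exact h0.trans_lt (hcurv i (by omega))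
      have hrr : ⟪r i, r i⟫ ≠ 0 := inner_self_ne_zero.mpr (hrne i (by omega))
      have horth : ⟪r (i + 1), d i⟫ = 0 := by
        rw [hrs, inner_sub_left, real_inner_smul_left, real_inner_comm (d i) (H (d i)), hrd, hα,
          div_mul_cancel₀ _ hpos.ne', sub_self]
      refine ⟨?_, ?_, ?_⟩
      · rw [hds, inner_add_right, real_inner_smul_right, horth, mul_zero, add_zero]
      · rw [hδs, hds, inner_add_add_self, real_inner_smul_right, real_inner_smul_left,
          real_inner_smul_left, real_inner_smul_right, real_inner_comm (r (i + 1)) (d i), horth, hδ]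
        ring
      · have hβr : ⟪r (i + 1), r (i + 1)⟫ = β (i + 1) * ⟪r i, r i⟫ := by
          rw [hβ, div_mul_cancel₀ _ hrr]
        calc ⟪r (i + 1), r (i + 1)⟫ ^ 2 = β (i + 1) ^ 2 * ⟪r i, r i⟫ ^ 2 := by
              rw [hβr, mul_pow]
          _ ≤ β (i + 1) ^ 2 * (δ i * ⟪g, g⟫) := by gcongr
          _ ≤ δ (i + 1) * ⟪g, g⟫ := by
              rw [hδs, add_mul, mul_assoc]
              exact le_add_of_nonneg_left
                (mul_nonneg real_inner_self_nonneg real_inner_self_nonneg)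
  have step : ∀ i ≤ k, ‖α i • d i‖ ≤ ‖g‖ / ε := by
    intro i hi
    obtain ⟨-, hδ, hG⟩ := inv i (by omega)
    have hcurv' := hcurv i hi
    rw [hδ, real_inner_comm (d i) (H (d i)), real_inner_self_eq_norm_sq] at hcurv'
    have hpos : 0 < ⟪d i, H (d i)⟫ :=
      (by positivity : 0 ≤ ε * ‖d i‖ ^ 2).trans_lt hcurv'
    rw [hδ, real_inner_self_eq_norm_sq (d i), real_inner_self_eq_norm_sq g, ← mul_pow] at hG
    have hrd : ⟪r i, r i⟫ ≤ ‖d i‖ * ‖g‖ := (sq_le_sq₀ real_inner_self_nonneg (by positivity)).mp hG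
    rw [norm_smul, hα, Real.norm_of_nonneg (div_nonneg real_inner_self_nonneg hpos.le),
      div_mul_eq_mul_div, div_le_div_iff₀ hpos hε]
    calc ⟪r i, r i⟫ * ‖d i‖ * ε ≤ ‖d i‖ * ‖g‖ * ‖d i‖ * ε := by gcongr
      _ = ‖g‖ * (ε * ‖d i‖ ^ 2) := by ring
      _ ≤ ‖g‖ * ⟪d i, H (d i)⟫ := by gcongr
  refine ⟨fun i hi => (inv i hi).2.1, fun i => ?_⟩
  induction i with
  | zero => simp [hη0]
  | succ i ih =>
    intro hi
    calc ‖η (i + 1)‖ ≤ ‖η i‖ + ‖α i • d i‖ := by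
          rw [hηs]
          exact norm_add_le _ _
      _ ≤ (i : ℝ) / ε * ‖g‖ + ‖g‖ / ε := add_le_add (ih (by omega)) (step i (by omega))
      _ = ((i + 1 : ℕ) : ℝ) / ε * ‖g‖ := by
          push_cast
          ring
end

section
/- Let E be a finite-dimensional real inner product space and P : E → E a self-adjoint positive-definite invertible linear operator satisfying p₁‖v‖² ≤ ⟨P v, v⟩ ≤ p₂‖v‖² for all v ∈ E, where 0 < p₁ ≤ p₂. Then for every g ∈ E one has ⟨P⁻¹ g, g⟩² ≥ (p₁ / p₂) · ‖P⁻¹ g‖² · ‖g‖². -/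
open scoped RealInnerProductSpace

/-- A symmetric positive semidefinite operator `T ≤ c` satisfies `T² ≤ c T`. -/
theorem LinearMap.IsSymmetric.norm_sq_apply_le_mul_inner
    {E : Type*} [NormedAddCommGroup E] [InnerProductSpace ℝ E]
    {T : E →ₗ[ℝ] E} (hT : T.IsSymmetric) {c : ℝ} (hc : 0 < c)
    (hnonneg : ∀ v : E, 0 ≤ ⟪T v, v⟫) (hle : ∀ v : E, ⟪T v, v⟫ ≤ c * ‖v‖ ^ 2) (x : E) :
    ‖T x‖ ^ 2 ≤ c * ⟪T x, x⟫ := by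
  have h := hnonneg (c • x - T x)
  have hsym : ⟪T (T x), x⟫ = ‖T x‖ ^ 2 := by
    rw [hT (T x) x, real_inner_self_eq_norm_sq]
  simp only [map_sub, map_smul, inner_sub_left, inner_sub_right, real_inner_smul_left,
    real_inner_smul_right, hsym, real_inner_self_eq_norm_sq] at h
  have hTx := hle (T x)
  refine le_of_mul_le_mul_left ?_ hc
  linarith

/-- Let `E` be a finite-dimensional real inner product space and `P` a self-adjoint
positive-definite invertible linear operator satisfying
`p₁ * ‖v‖² ≤ ⟪P v, v⟫ ≤ p₂ * ‖v‖²` for all `v`, with `0 < p₁ ≤ p₂`.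
Then for every `g ∈ E`, `⟪P⁻¹ g, g⟫² ≥ (p₁ / p₂) * ‖P⁻¹ g‖² * ‖g‖²`. -/
theorem preconditioner_cauchy_schwarz_bound
    {E : Type*} [NormedAddCommGroup E] [InnerProductSpace ℝ E] [FiniteDimensional ℝ E]
    (P : E ≃ₗ[ℝ] E) (hPsym : LinearMap.IsSymmetric (P : E →ₗ[ℝ] E))
    (hPpos : ∀ v : E, v ≠ 0 → 0 < ⟪(P : E →ₗ[ℝ] E) v, v⟫)
    (p₁ p₂ : ℝ) (hp₁ : 0 < p₁) (hp₁₂ : p₁ ≤ p₂)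
    (hPbound : ∀ v : E,
      p₁ * ‖v‖ ^ 2 ≤ ⟪(P : E →ₗ[ℝ] E) v, v⟫ ∧ ⟪(P : E →ₗ[ℝ] E) v, v⟫ ≤ p₂ * ‖v‖ ^ 2)
    (g : E) :
    ⟪P.symm g, g⟫ ^ 2 ≥ (p₁ / p₂) * ‖P.symm g‖ ^ 2 * ‖g‖ ^ 2 := by
  have hp₂ : 0 < p₂ := hp₁.trans_le hp₁₂
  have hlower : p₁ * ‖P.symm g‖ ^ 2 ≤ ⟪P.symm g, g⟫ := by
    simpa [real_inner_comm] using (hPbound (P.symm g)).1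
  have hupper : ‖g‖ ^ 2 ≤ p₂ * ⟪P.symm g, g⟫ := by
    simpa [real_inner_comm] using hPsym.norm_sq_apply_le_mul_inner hp₂
      (fun v ↦ (by positivity : 0 ≤ p₁ * ‖v‖ ^ 2).trans (hPbound v).1)
      (fun v ↦ (hPbound v).2) (P.symm g)
  calc p₁ / p₂ * ‖P.symm g‖ ^ 2 * ‖g‖ ^ 2
      = (p₁ * ‖P.symm g‖ ^ 2) * (‖g‖ ^ 2 / p₂) := by ring
    _ ≤ ⟪P.symm g, g⟫ * ⟪P.symm g, g⟫ := by
      refine mul_le_mul hlower ((div_le_iff₀' hp₂).2 hupper) (by positivity) ?_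
      exact (by positivity : 0 ≤ p₁ * ‖P.symm g‖ ^ 2).trans hlower
    _ = ⟪P.symm g, g⟫ ^ 2 := (sq _).symm
end

section
/- Let {fₖ} be a sequence of real numbers bounded below, and let {aₖ}, {bₖ}, {cₖ} be sequences of real numbers with aₖ > 0 and cₖ > 0 for all k. Suppose there are constants χ₁, χ₂, γ₁, γ₂ > 0 such that for every k: bₖ ≥ γ₁ aₖ², cₖ ≤ γ₂ aₖ, and fₖ − fₖ₊₁ ≥ min(χ₁ bₖ² / cₖ², χ₂ bₖ). Then bₖ → 0 and aₖ → 0 as k → ∞. -/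
open Filter Topology in
/-- The decrements of an antitone real sequence that is bounded below tend to zero. -/
theorem Antitone.tendsto_sub_succ_zero {f : ℕ → ℝ} (hf : Antitone f)
    (hfb : BddBelow (Set.range f)) :
    Tendsto (fun k => f k - f (k + 1)) atTop (𝓝 0) := by
  have h := tendsto_atTop_ciInf hf hfb
  simpa using h.sub (h.comp (tendsto_add_atTop_nat 1))

/-- Sufficient descent along directions of controlled norm bounds `b² / c²` below by a
multiple of `b`. -/
theorem mul_le_sq_div_sq_of_sufficient_descent {a b c γ₁ γ₂ : ℝ} (hc : 0 < c)
    (hγ₁ : 0 < γ₁) (hγ₂ : 0 < γ₂) (hba : γ₁ * a ^ 2 ≤ b) (hca : c ≤ γ₂ * a) :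
    γ₁ / γ₂ ^ 2 * b ≤ b ^ 2 / c ^ 2 := by
  have hb : 0 ≤ b := (by positivity : 0 ≤ γ₁ * a ^ 2).trans hba
  have hc2 : c ^ 2 ≤ γ₂ ^ 2 * a ^ 2 := by
    rw [← mul_pow]
    gcongr
  rw [div_mul_eq_mul_div, div_le_div_iff₀ (by positivity) (by positivity)]
  calc γ₁ * b * c ^ 2 ≤ γ₁ * b * (γ₂ ^ 2 * a ^ 2) := by gcongr
    _ = b * (γ₁ * a ^ 2) * γ₂ ^ 2 := by ring
    _ ≤ b * b * γ₂ ^ 2 := by gcongr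
    _ = b ^ 2 * γ₂ ^ 2 := by ring

/-- Let `{fₖ}` be a sequence of reals bounded below, and `{aₖ}, {bₖ}, {cₖ}` sequences
of reals with `aₖ > 0`, `cₖ > 0`. If there are constants `χ₁, χ₂, γ₁, γ₂ > 0` with
`bₖ ≥ γ₁ aₖ²`, `cₖ ≤ γ₂ aₖ`, and `fₖ - fₖ₊₁ ≥ min (χ₁ bₖ² / cₖ²) (χ₂ bₖ)` for every
`k`, then `bₖ → 0` and `aₖ → 0`. -/
theorem descent_method_global_convergence
    (f a b c : ℕ → ℝ) (hfb : BddBelow (Set.range f))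
    (ha : ∀ k, 0 < a k) (hc : ∀ k, 0 < c k)
    (χ₁ χ₂ γ₁ γ₂ : ℝ) (hχ₁ : 0 < χ₁) (hχ₂ : 0 < χ₂) (hγ₁ : 0 < γ₁) (hγ₂ : 0 < γ₂)
    (hba : ∀ k, b k ≥ γ₁ * (a k) ^ 2)
    (hca : ∀ k, c k ≤ γ₂ * a k)
    (hdec : ∀ k, f k - f (k + 1) ≥ min (χ₁ * (b k) ^ 2 / (c k) ^ 2) (χ₂ * b k)) :
    Filter.Tendsto b Filter.atTop (nhds 0) ∧ Filter.Tendsto a Filter.atTop (nhds 0) := by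
  have hb : ∀ k, 0 ≤ b k := fun k =>
    (by positivity : 0 ≤ γ₁ * a k ^ 2).trans (hba k)
  set m := min (χ₁ * (γ₁ / γ₂ ^ 2)) χ₂ with hm
  have hm0 : 0 < m := lt_min (by positivity) hχ₂
  have hmb : ∀ k, m * b k ≤ f k - f (k + 1) := fun k => by
    refine le_trans ?_ (hdec k)
    rw [hm, min_mul_of_nonneg _ _ (hb k), mul_assoc, mul_div_assoc]
    have h := mul_le_sq_div_sq_of_sufficient_descent (hc k) hγ₁ hγ₂ (hba k) (hca k)
    gcongr
  have hf : Antitone f := antitone_nat_of_succ_le fun k =>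
    sub_nonneg.mp ((mul_nonneg hm0.le (hb k)).trans (hmb k))
  have hb0 : Filter.Tendsto b Filter.atTop (nhds 0) := by
    refine squeeze_zero hb (fun k => (le_div_iff₀' hm0).mpr (hmb k)) ?_
    simpa using (hf.tendsto_sub_succ_zero hfb).div_const m
  refine ⟨hb0, squeeze_zero (fun k => (ha k).le)
    (fun k => Real.le_sqrt_of_sq_le ((le_div_iff₀' hγ₁).mpr (hba k))) ?_⟩
  simpa using (hb0.div_const γ₁).sqrt
end

section
/- Let n be a positive integer and let A, M ∈ ℝ^{n×n} be symmetric positive definite matrices. Then the generalized Lyapunov operator F ↦ AFM + MFA is positive definite on symmetric matrices: for every symmetric F ∈ ℝ^{n×n}, tr(F (AFM + MFA)) ≥ 0, and tr(F (AFM + MFA)) = 0 if and only if F = 0. -/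
open Matrix

open scoped MatrixOrder in
/-- A real positive definite matrix factors as `Pᴴ * P` with `P` invertible. -/
theorem Matrix.PosDef.exists_isUnit_conjTranspose_mul_self {ι : Type*} [Fintype ι] [DecidableEq ι]
    {A : Matrix ι ι ℝ} (hA : A.PosDef) : ∃ P : Matrix ι ι ℝ, IsUnit P ∧ A = Pᴴ * P := by
  obtain ⟨P, hP⟩ := CStarAlgebra.nonneg_iff_eq_star_mul_self.mp hA.posSemidef.nonneg
  rw [star_eq_conjTranspose] at hP
  refine ⟨P, ?_, hP⟩
  have hU := hA.isUnit
  rw [hP, isUnit_iff_isUnit_det, det_mul] at hU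
  exact (isUnit_iff_isUnit_det P).mpr (isUnit_of_mul_isUnit_right hU)

/-- For positive definite `A`, `M` the form `F ↦ tr (Fᴴ A F M)` is positive definite. -/
theorem Matrix.PosDef.trace_conjTranspose_mul_mul_mul {ι : Type*} [Fintype ι] [DecidableEq ι]
    {A M : Matrix ι ι ℝ} (hA : A.PosDef) (hM : M.PosDef) (F : Matrix ι ι ℝ) :
    0 ≤ (Fᴴ * A * F * M).trace ∧ ((Fᴴ * A * F * M).trace = 0 ↔ F = 0) := by
  obtain ⟨P, hP, rfl⟩ := hA.exists_isUnit_conjTranspose_mul_self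
  obtain ⟨Q, hQ, rfl⟩ := hM.exists_isUnit_conjTranspose_mul_self
  have key : (Fᴴ * (Pᴴ * P) * F * (Qᴴ * Q)).trace
      = ((P * F * Qᴴ)ᴴ * (P * F * Qᴴ)).trace := by
    rw [← Matrix.mul_assoc _ Qᴴ Q, trace_mul_comm]
    simp only [conjTranspose_mul, conjTranspose_conjTranspose, Matrix.mul_assoc]
  have hQ' : IsUnit Qᴴ := hQ.star
  rw [key, trace_conjTranspose_mul_self_eq_zero_iff, hQ'.mul_left_eq_zero, hP.mul_right_eq_zero]
  exact ⟨(posSemidef_conjTranspose_mul_self _).trace_nonneg, Iff.rfl⟩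

/-- For symmetric positive definite `A, M ∈ ℝ^{n×n}`, the generalized Lyapunov
operator `F ↦ AFM + MFA` is positive definite on symmetric matrices:
`tr(F (AFM + MFA)) ≥ 0` for symmetric `F`, with equality iff `F = 0`. -/
theorem lyapunov_operator_posDef
    (n : ℕ) (hn : 0 < n) (A M : Matrix (Fin n) (Fin n) ℝ)
    (hA : A.PosDef) (hM : M.PosDef)
    (F : Matrix (Fin n) (Fin n) ℝ) (hF : F.IsSymm) :
    0 ≤ (F * (A * F * M + M * F * A)).trace ∧
    ((F * (A * F * M + M * F * A)).trace = 0 ↔ F = 0) := by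
  have hF' : Fᴴ = F := by rw [conjTranspose_eq_transpose_of_trivial, hF.eq]
  obtain ⟨h₁, h₁_zero⟩ := hA.trace_conjTranspose_mul_mul_mul hM F
  obtain ⟨h₂, h₂_zero⟩ := hM.trace_conjTranspose_mul_mul_mul hA F
  rw [hF'] at h₁ h₁_zero h₂ h₂_zero
  have hsum : (F * (A * F * M + M * F * A)).trace
      = (F * A * F * M).trace + (F * M * F * A).trace := by
    simp only [Matrix.mul_add, trace_add, Matrix.mul_assoc]
  rw [hsum, add_eq_zero_iff_of_nonneg h₁ h₂, h₁_zero, h₂_zero, and_self]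
  exact ⟨add_nonneg h₁ h₂, Iff.rfl⟩
end

section
/- Let Y ∈ ℝ^{n×p} have full column rank and let ξ = Y S + Z with S ∈ ℝ^{p×p} symmetric and Yᵀ Z = 0. Then tr(Yᵀ ξ Yᵀ ξ) ≥ 0, and consequently 2 tr(Yᵀ ξ Yᵀ ξ) + 2 tr(Yᵀ Y ξᵀ ξ) ≥ 2 λ_min(Yᵀ Y) · tr(ξᵀ ξ), where λ_min(YᵀY) denotes the smallest eigenvalue of the symmetric positive definite matrix YᵀY. -/
open Matrix

/-- A real symmetric matrix dominates its smallest eigenvalue times the identity. -/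
theorem Matrix.IsHermitian.posSemidef_sub_iInf_eigenvalues_smul_one {m : Type*} [Fintype m]
    [DecidableEq m] {A : Matrix m m ℝ} (hA : A.IsHermitian) :
    (A - (⨅ i, hA.eigenvalues i) • (1 : Matrix m m ℝ)).PosSemidef := by
  set c := ⨅ i, hA.eigenvalues i
  set U : Matrix m m ℝ := (hA.eigenvectorUnitary : Matrix m m ℝ)
  have hU : U * Uᴴ = 1 := Unitary.mul_star_self_of_mem hA.eigenvectorUnitary.2
  have hdiag : (diagonal fun i => hA.eigenvalues i - c).PosSemidef :=
    PosSemidef.diagonal fun i => sub_nonneg.2 (ciInf_le (Set.finite_range _).bddBelow i)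
  have hspec : A = U * diagonal hA.eigenvalues * Uᴴ := by
    rw [← star_eq_conjTranspose]
    simpa [Unitary.conjStarAlgAut_apply] using hA.spectral_theorem
  have hsub : (diagonal fun i => hA.eigenvalues i - c) =
      diagonal hA.eigenvalues - c • (1 : Matrix m m ℝ) := by
    rw [smul_one_eq_diagonal, diagonal_sub]
  have hconj : A - c • (1 : Matrix m m ℝ) =
      U * (diagonal fun i => hA.eigenvalues i - c) * Uᴴ := by
    rw [hsub, mul_sub, sub_mul, ← hspec, Matrix.mul_smul, mul_one,
      Matrix.smul_mul, hU]
  rw [hconj]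
  exact hdiag.mul_mul_conjTranspose_same U

/-- The trace of `A * (Bᵀ * B)` is at least the smallest eigenvalue of `A` times the squared
Frobenius norm of `B`. -/
theorem Matrix.IsHermitian.iInf_eigenvalues_mul_trace_le {m l : Type*} [Fintype m]
    [DecidableEq m] [Fintype l] {A : Matrix m m ℝ} (hA : A.IsHermitian) (B : Matrix l m ℝ) :
    (⨅ i, hA.eigenvalues i) * (Bᵀ * B).trace ≤ (A * Bᵀ * B).trace := by
  have h := (hA.posSemidef_sub_iInf_eigenvalues_smul_one.mul_mul_conjTranspose_same B).trace_nonneg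
  rw [conjTranspose_eq_transpose_of_trivial, Matrix.mul_assoc, trace_mul_comm, Matrix.sub_mul,
    Matrix.sub_mul, trace_sub, Matrix.smul_mul, Matrix.one_mul, Matrix.smul_mul, trace_smul,
    smul_eq_mul] at h
  exact sub_nonneg.1 h

/-- For symmetric `S`, the trace of `(Yᵀ * Y * S)²` is the squared Frobenius norm of
`Y * S * Yᵀ`, hence nonnegative. -/
theorem Matrix.IsSymm.trace_gram_mul_gram_mul_nonneg {m l : Type*} [Fintype m] [Fintype l]
    {S : Matrix m m ℝ} (hS : S.IsSymm) (Y : Matrix l m ℝ) :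
    0 ≤ (Yᵀ * Y * S * (Yᵀ * Y * S)).trace := by
  have h := (posSemidef_conjTranspose_mul_self (Y * S * Yᵀ)).trace_nonneg
  rw [conjTranspose_eq_transpose_of_trivial, transpose_mul, transpose_mul, transpose_transpose,
    hS.eq] at h
  have hcycle : (Yᵀ * Y * S * (Yᵀ * Y * S)).trace = (Y * (S * Yᵀ) * (Y * S * Yᵀ)).trace := by
    rw [show Yᵀ * Y * S * (Yᵀ * Y * S) = Yᵀ * (Y * S * Yᵀ * Y * S) by
      simp only [Matrix.mul_assoc], trace_mul_comm]
    simp only [Matrix.mul_assoc]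
  rwa [hcycle]

/-- For `Y ∈ ℝ^{n×p}` of full column rank and a horizontal vector
`ξ = Y S + Z` (with `Sᵀ = S` and `Yᵀ Z = 0`), one has `tr(Yᵀ ξ Yᵀ ξ) ≥ 0`,
and consequently
`2 tr(Yᵀ ξ Yᵀ ξ) + 2 tr(Yᵀ Y ξᵀ ξ) ≥ 2 λ_min(YᵀY) tr(ξᵀ ξ)`. -/
theorem horizontal_metric_lower_bound
    {n p : ℕ} (Y : Matrix (Fin n) (Fin p) ℝ) (hY : Y.rank = p)
    (hYY : (Yᵀ * Y).IsHermitian)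
    (S : Matrix (Fin p) (Fin p) ℝ) (hS : S.IsSymm)
    (Z : Matrix (Fin n) (Fin p) ℝ) (hZ : Yᵀ * Z = 0)
    (ξ : Matrix (Fin n) (Fin p) ℝ) (hξ : ξ = Y * S + Z) :
    0 ≤ (Yᵀ * ξ * Yᵀ * ξ).trace ∧
    2 * (Yᵀ * ξ * Yᵀ * ξ).trace + 2 * (Yᵀ * Y * ξᵀ * ξ).trace ≥
      2 * (⨅ i, hYY.eigenvalues i) * (ξᵀ * ξ).trace := by
  have hYξ : Yᵀ * ξ = Yᵀ * Y * S := by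
    rw [hξ, Matrix.mul_add, hZ, add_zero, Matrix.mul_assoc]
  have hnonneg : 0 ≤ (Yᵀ * ξ * Yᵀ * ξ).trace := by
    rw [Matrix.mul_assoc (Yᵀ * ξ), hYξ]
    exact hS.trace_gram_mul_gram_mul_nonneg Y
  refine ⟨hnonneg, ?_⟩
  linarith [hYY.iInf_eigenvalues_mul_trace_le ξ]
end

section
/- Let A, M ∈ ℝ^{n×n} be symmetric positive definite, C ∈ ℝ^{n×n} symmetric, and Y ∈ ℝ^{n×p} of full column rank. Set P = Y (YᵀY)⁻¹ Yᵀ, R = A Y Yᵀ M + M Y Yᵀ A − C, and 𝓡 = ‖R‖_F. Then for every horizontal vector ξ = Y S + Z (with Sᵀ = S and YᵀZ = 0), letting F = Y ξᵀ + ξ Yᵀ, the Riemannian Hessian quadratic form satisfies tr(F (AFM + MFA)) + 2 tr(ξᵀ (I − P) R (I − P) ξ) ≥ (4 λ_min(YᵀY) λ_min(A) λ_min(M) − 2 p 𝓡) · tr(ξᵀ ξ). In particular, if 2 λ_min(YᵀY) λ_min(A) λ_min(M) > p 𝓡, then this quadratic form is strictly positive for every such nonzero ξ. -/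
open Matrix

namespace Matrix

variable {m n : Type*} [Fintype m] [Fintype n]

/-- The trace of a product of two real positive semidefinite matrices is nonnegative. -/
theorem PosSemidef.trace_mul_nonneg {H K : Matrix n n ℝ} (hH : H.PosSemidef)
    (hK : K.PosSemidef) : 0 ≤ (H * K).trace := by
  classical
  open scoped MatrixOrder in
  obtain ⟨B, rfl⟩ := CStarAlgebra.nonneg_iff_eq_star_mul_self.mp hH.nonneg
  have h := (hK.mul_mul_conjTranspose_same B).trace_nonneg
  rwa [trace_mul_comm, ← Matrix.mul_assoc] at h

/-- Subtracting the smallest eigenvalue from a Hermitian matrix leaves it positive semidefinite. -/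
theorem IsHermitian.posSemidef_sub_iInf_eigenvalues [DecidableEq n] {A : Matrix n n ℝ}
    (hA : A.IsHermitian) : (A - (⨅ i, hA.eigenvalues i) • (1 : Matrix n n ℝ)).PosSemidef := by
  set l := ⨅ i, hA.eigenvalues i
  let U : Matrix n n ℝ := hA.eigenvectorUnitary
  have hU : U * Uᴴ = 1 := Unitary.mul_star_self_of_mem hA.eigenvectorUnitary.2
  have hD : (diagonal (fun i => hA.eigenvalues i - l)).PosSemidef :=
    posSemidef_diagonal_iff.mpr fun i =>
      sub_nonneg.mpr (ciInf_le (Set.finite_range _).bddBelow i)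
  have hd : diagonal (fun i => hA.eigenvalues i - l) =
      diagonal hA.eigenvalues - l • (1 : Matrix n n ℝ) := by
    rw [smul_one_eq_diagonal, diagonal_sub]
  have hspec : A = U * diagonal hA.eigenvalues * Uᴴ := by
    conv_lhs => rw [hA.spectral_theorem]
    rfl
  have h := hD.mul_mul_conjTranspose_same U
  rwa [hd, Matrix.mul_sub, Matrix.sub_mul, ← hspec, Matrix.mul_smul, Matrix.smul_mul,
    Matrix.mul_one, hU] at h

/-- The trace against a positive semidefinite matrix is bounded below by the smallest eigenvalue. -/
theorem IsHermitian.iInf_eigenvalues_mul_trace_le_s15 [DecidableEq n] {A K : Matrix n n ℝ}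
    (hA : A.IsHermitian) (hK : K.PosSemidef) :
    (⨅ i, hA.eigenvalues i) * K.trace ≤ (A * K).trace := by
  have h := hA.posSemidef_sub_iInf_eigenvalues.trace_mul_nonneg hK
  rw [Matrix.sub_mul, trace_sub, Matrix.smul_mul, Matrix.one_mul, trace_smul, smul_eq_mul] at h
  linarith

theorem trace_transpose_mul_self_nonneg (W : Matrix m n ℝ) : 0 ≤ (Wᵀ * W).trace := by
  simpa [conjTranspose_eq_transpose_of_trivial] using
    (posSemidef_conjTranspose_mul_self W).trace_nonneg

theorem trace_transpose_mul_eq_sum (V W : Matrix m n ℝ) :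
    (Vᵀ * W).trace = ∑ x : m × n, V x.1 x.2 * W x.1 x.2 := by
  rw [Fintype.sum_prod_type_right]
  rfl

/-- Cauchy–Schwarz for the Frobenius inner product. -/
theorem abs_trace_transpose_mul_le (V W : Matrix m n ℝ) :
    |(Vᵀ * W).trace| ≤ √(Vᵀ * V).trace * √(Wᵀ * W).trace := by
  rw [← Real.sqrt_mul (trace_transpose_mul_self_nonneg V)]
  refine Real.abs_le_sqrt ?_
  simp only [trace_transpose_mul_eq_sum, ← sq]
  exact Finset.sum_mul_sq_le_sq_mul_sq _ _ _

/-- The Frobenius norm of a Gram matrix is at most its trace. -/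
theorem sqrt_trace_gram_le (Z : Matrix m n ℝ) :
    √(((Z * Zᵀ)ᵀ * (Z * Zᵀ)).trace) ≤ (Zᵀ * Z).trace := by
  refine Real.sqrt_le_iff.mpr ⟨trace_transpose_mul_self_nonneg Z, ?_⟩
  rw [trace_transpose_mul_eq_sum, trace_mul_comm Zᵀ Z, Fintype.sum_prod_type, sq, trace,
    Finset.sum_mul_sum]
  refine Finset.sum_le_sum fun i _ => Finset.sum_le_sum fun j _ => ?_
  simpa [Matrix.mul_apply, ← sq] using Finset.sum_mul_sq_le_sq_mul_sq Finset.univ (Z i) (Z j)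

theorem abs_trace_transpose_mul_mul_le (R : Matrix m m ℝ) (Z : Matrix m n ℝ) :
    |(Zᵀ * R * Z).trace| ≤ √(Rᵀ * R).trace * (Zᵀ * Z).trace := by
  have h : (Zᵀ * R * Z).trace = (Rᵀ * (Z * Zᵀ)).trace := by
    rw [← trace_transpose (Zᵀ * R * Z)]
    simp only [transpose_mul, transpose_transpose]
    rw [trace_mul_comm, Matrix.mul_assoc]
  rw [h]
  exact (abs_trace_transpose_mul_le R (Z * Zᵀ)).trans
    (mul_le_mul_of_nonneg_left (sqrt_trace_gram_le Z) (Real.sqrt_nonneg _))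

/-- The generalized Lyapunov form is bounded below by the smallest eigenvalues. -/
theorem PosDef.trace_lyapunov_ge [DecidableEq n] {A M F : Matrix n n ℝ} (hA : A.PosDef)
    (hM : M.PosDef) (hF : F.IsSymm) :
    2 * ((⨅ i, hA.1.eigenvalues i) * (⨅ i, hM.1.eigenvalues i)) * (F * F).trace ≤
      (F * (A * F * M + M * F * A)).trace := by
  have hFF : (F * F).PosSemidef := by
    simpa [conjTranspose_eq_transpose_of_trivial, hF.eq] using posSemidef_conjTranspose_mul_self F
  have hFAF : (F * A * F).PosSemidef := by
    simpa [conjTranspose_eq_transpose_of_trivial, hF.eq] using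
      hA.posSemidef.conjTranspose_mul_mul_same F
  have h1 := hA.1.iInf_eigenvalues_mul_trace_le_s15 hFF
  have h2 := hM.1.iInf_eigenvalues_mul_trace_le_s15 hFAF
  have h3 : (F * A * F).trace = (A * (F * F)).trace := by
    rw [Matrix.mul_assoc, trace_mul_comm, Matrix.mul_assoc]
  have h4 : (F * (A * F * M)).trace = (M * (F * A * F)).trace := by
    rw [trace_mul_comm M]
    simp only [Matrix.mul_assoc]
  have h5 : (F * (M * F * A)).trace = (M * (F * A * F)).trace := by
    rw [trace_mul_comm]
    simp only [Matrix.mul_assoc]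
  have h6 : 0 ≤ ⨅ i, hM.1.eigenvalues i := Real.iInf_nonneg fun i => (hM.eigenvalues_pos i).le
  rw [Matrix.mul_add, trace_add, h4, h5]
  rw [h3] at h2
  nlinarith [mul_le_mul_of_nonneg_left h1 h6]

/-- Lower bound for the squared Frobenius norm of `Y ξᵀ + ξ Yᵀ` at a horizontal vector `ξ`. -/
theorem trace_symm_sq_ge [DecidableEq n] {Y Z : Matrix m n ℝ} {S : Matrix n n ℝ}
    (hYY : (Yᵀ * Y).IsHermitian) (hS : S.IsSymm) (hZ : Yᵀ * Z = 0) {ξ : Matrix m n ℝ}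
    (hξ : ξ = Y * S + Z) :
    2 * (⨅ i, hYY.eigenvalues i) * (ξᵀ * ξ).trace ≤
      ((Y * ξᵀ + ξ * Yᵀ) * (Y * ξᵀ + ξ * Yᵀ)).trace := by
  have hG : (Yᵀ * Y).PosSemidef := by
    simpa [conjTranspose_eq_transpose_of_trivial] using posSemidef_conjTranspose_mul_self Y
  have hK : (ξᵀ * ξ).PosSemidef := by
    simpa [conjTranspose_eq_transpose_of_trivial] using posSemidef_conjTranspose_mul_self ξ
  have h1 := hYY.iInf_eigenvalues_mul_trace_le_s15 hK
  have hYξ : Yᵀ * ξ = Yᵀ * Y * S := by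
    rw [hξ, Matrix.mul_add, hZ, add_zero, Matrix.mul_assoc]
  have hξY : ξᵀ * Y = S * (Yᵀ * Y) := by
    have := congrArg transpose hYξ
    simpa [transpose_mul, hS.eq] using this
  have h2 : 0 ≤ (Yᵀ * Y * (S * (Yᵀ * Y) * S)).trace := by
    refine hG.trace_mul_nonneg ?_
    simpa [conjTranspose_eq_transpose_of_trivial, hS.eq] using hG.conjTranspose_mul_mul_same S
  have e1 : (Y * ξᵀ * (Y * ξᵀ)).trace = (Yᵀ * Y * (S * (Yᵀ * Y) * S)).trace := by
    have : (Y * ξᵀ * (Y * ξᵀ)).trace = (ξᵀ * Y * (ξᵀ * Y)).trace := by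
      rw [Matrix.mul_assoc, trace_mul_comm]
      simp only [Matrix.mul_assoc]
    rw [this, hξY, trace_mul_comm (Yᵀ * Y)]
    simp only [Matrix.mul_assoc]
  have e2 : (ξ * Yᵀ * (ξ * Yᵀ)).trace = (Yᵀ * Y * (S * (Yᵀ * Y) * S)).trace := by
    have : (ξ * Yᵀ * (ξ * Yᵀ)).trace = (Yᵀ * ξ * (Yᵀ * ξ)).trace := by
      rw [Matrix.mul_assoc, trace_mul_comm]
      simp only [Matrix.mul_assoc]
    rw [this, hYξ]
    simp only [Matrix.mul_assoc]
  have e3 : (Y * ξᵀ * (ξ * Yᵀ)).trace = (Yᵀ * Y * (ξᵀ * ξ)).trace := by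
    rw [← Matrix.mul_assoc, trace_mul_comm]
    simp only [Matrix.mul_assoc]
  have e4 : (ξ * Yᵀ * (Y * ξᵀ)).trace = (Yᵀ * Y * (ξᵀ * ξ)).trace := by
    rw [Matrix.mul_assoc, trace_mul_comm]
    simp only [Matrix.mul_assoc]
  rw [Matrix.add_mul, Matrix.mul_add, Matrix.mul_add, trace_add, trace_add, trace_add, e1, e2, e3,
    e4]
  linarith

theorem isUnit_of_rank_eq_card [DecidableEq n] {K : Type*} [Field K] {A : Matrix n n K}
    (h : A.rank = Fintype.card n) : IsUnit A := by
  rw [← mulVec_surjective_iff_isUnit]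
  refine (LinearMap.range_eq_top (f := A.mulVecLin)).mp (Submodule.eq_top_of_finrank_eq ?_)
  rw [Module.finrank_fintype_fun_eq_card, ← h]
  rfl

/-- The orthogonal projection onto the complement of the range of `Y` removes `Y S`. -/
theorem one_sub_proj_mul [DecidableEq m] [DecidableEq n] {Y : Matrix m n ℝ}
    (hY : Y.rank = Fintype.card n) (S : Matrix n n ℝ) {Z : Matrix m n ℝ} (hZ : Yᵀ * Z = 0) :
    (1 - Y * (Yᵀ * Y)⁻¹ * Yᵀ) * (Y * S + Z) = Z := by
  have hu : IsUnit (Yᵀ * Y).det := by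
    rw [← isUnit_iff_isUnit_det]
    exact isUnit_of_rank_eq_card ((rank_transpose_mul_self Y).trans hY)
  have h : Y * (Yᵀ * Y)⁻¹ * Yᵀ * (Y * S) = Y * S := by
    calc Y * (Yᵀ * Y)⁻¹ * Yᵀ * (Y * S) = Y * ((Yᵀ * Y)⁻¹ * (Yᵀ * Y)) * S := by
          simp only [Matrix.mul_assoc]
      _ = Y * S := by rw [nonsing_inv_mul _ hu, Matrix.mul_one]
  rw [Matrix.sub_mul, Matrix.one_mul, Matrix.mul_add, h, Matrix.mul_assoc _ Yᵀ Z, hZ,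
    Matrix.mul_zero]
  abel

end Matrix

/-- Positivity bound for the Riemannian Hessian quadratic form: for symmetric
positive definite `A, M`, symmetric `C`, and full-column-rank `Y`, with
`P = Y (YᵀY)⁻¹ Yᵀ`, `R = A Y Yᵀ M + M Y Yᵀ A − C`, `𝓡 = ‖R‖_F`, every horizontal
vector `ξ = Y S + Z` (`Sᵀ = S`, `YᵀZ = 0`), with `F = Y ξᵀ + ξ Yᵀ`, satisfies
`tr(F (AFM + MFA)) + 2 tr(ξᵀ (I − P) R (I − P) ξ)
  ≥ (4 λ_min(YᵀY) λ_min(A) λ_min(M) − 2 p 𝓡) tr(ξᵀ ξ)`.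
In particular, if `2 λ_min(YᵀY) λ_min(A) λ_min(M) > p 𝓡`, this quadratic form is
strictly positive for every such nonzero `ξ`. -/
theorem riemannian_hessian_quadratic_form_bound
    {n p : ℕ} (A M C : Matrix (Fin n) (Fin n) ℝ)
    (hA : A.PosDef) (hM : M.PosDef) (hC : C.IsSymm)
    (Y : Matrix (Fin n) (Fin p) ℝ) (hY : Y.rank = p)
    (hYY : (Yᵀ * Y).IsHermitian)
    (P : Matrix (Fin n) (Fin n) ℝ) (hP : P = Y * (Yᵀ * Y)⁻¹ * Yᵀ)
    (R : Matrix (Fin n) (Fin n) ℝ) (hR : R = A * Y * Yᵀ * M + M * Y * Yᵀ * A - C)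
    (𝓡 : ℝ) (h𝓡 : 𝓡 = Real.sqrt ((Rᵀ * R).trace)) :
    (∀ (S : Matrix (Fin p) (Fin p) ℝ) (Z ξ : Matrix (Fin n) (Fin p) ℝ),
      S.IsSymm → Yᵀ * Z = 0 → ξ = Y * S + Z →
      ((Y * ξᵀ + ξ * Yᵀ) *
          (A * (Y * ξᵀ + ξ * Yᵀ) * M + M * (Y * ξᵀ + ξ * Yᵀ) * A)).trace
        + 2 * (ξᵀ * (1 - P) * R * (1 - P) * ξ).trace ≥
      (4 * (⨅ i, hYY.eigenvalues i) * (⨅ i, hA.1.eigenvalues i) *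
          (⨅ i, hM.1.eigenvalues i) - 2 * (p : ℝ) * 𝓡) * (ξᵀ * ξ).trace) ∧
    (2 * (⨅ i, hYY.eigenvalues i) * (⨅ i, hA.1.eigenvalues i) *
        (⨅ i, hM.1.eigenvalues i) > (p : ℝ) * 𝓡 →
      ∀ (S : Matrix (Fin p) (Fin p) ℝ) (Z ξ : Matrix (Fin n) (Fin p) ℝ),
        S.IsSymm → Yᵀ * Z = 0 → ξ = Y * S + Z → ξ ≠ 0 →
        0 < ((Y * ξᵀ + ξ * Yᵀ) *
              (A * (Y * ξᵀ + ξ * Yᵀ) * M + M * (Y * ξᵀ + ξ * Yᵀ) * A)).trace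
          + 2 * (ξᵀ * (1 - P) * R * (1 - P) * ξ).trace) := by
  have key : ∀ (S : Matrix (Fin p) (Fin p) ℝ) (Z ξ : Matrix (Fin n) (Fin p) ℝ),
      S.IsSymm → Yᵀ * Z = 0 → ξ = Y * S + Z →
      ((Y * ξᵀ + ξ * Yᵀ) *
          (A * (Y * ξᵀ + ξ * Yᵀ) * M + M * (Y * ξᵀ + ξ * Yᵀ) * A)).trace
        + 2 * (ξᵀ * (1 - P) * R * (1 - P) * ξ).trace ≥
      (4 * (⨅ i, hYY.eigenvalues i) * (⨅ i, hA.1.eigenvalues i) *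
          (⨅ i, hM.1.eigenvalues i) - 2 * (p : ℝ) * 𝓡) * (ξᵀ * ξ).trace := by
    intro S Z ξ hS hZ hξ
    rcases Nat.eq_zero_or_pos p with rfl | hp
    · have hξ0 : ξ = 0 := Subsingleton.elim _ _
      simp [hξ0]
    have hF : (Y * ξᵀ + ξ * Yᵀ).IsSymm := by
      simp [IsSymm, transpose_add, transpose_mul, add_comm]
    have h1 := hA.trace_lyapunov_ge hM hF
    have h2 := trace_symm_sq_ge hYY hS hZ hξ
    have hl : 0 ≤ (⨅ i, hA.1.eigenvalues i) * (⨅ i, hM.1.eigenvalues i) :=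
      mul_nonneg (Real.iInf_nonneg fun i => (hA.eigenvalues_pos i).le)
        (Real.iInf_nonneg fun i => (hM.eigenvalues_pos i).le)
    have hQ : (1 - P) * ξ = Z := by
      rw [hP, hξ]
      exact one_sub_proj_mul (by simpa using hY) S hZ
    have hPt : Pᵀ = P := by
      rw [hP]
      simp [transpose_mul, transpose_nonsing_inv, Matrix.mul_assoc]
    have hQt : ξᵀ * (1 - P) = Zᵀ := by
      rw [← hQ, transpose_mul, transpose_sub, transpose_one, hPt]
    have h3 : ξᵀ * (1 - P) * R * (1 - P) * ξ = Zᵀ * R * Z := by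
      rw [hQt, Matrix.mul_assoc _ (1 - P) ξ, hQ]
    have h4 : (Zᵀ * Z).trace ≤ (ξᵀ * ξ).trace := by
      have hZY : Zᵀ * Y = 0 := by simpa [transpose_mul] using congrArg transpose hZ
      have hx : ξᵀ * ξ = (Y * S)ᵀ * (Y * S) + Zᵀ * Z := by
        rw [hξ, transpose_add, Matrix.add_mul, Matrix.mul_add, Matrix.mul_add,
          ← Matrix.mul_assoc Zᵀ, hZY, transpose_mul, Matrix.mul_assoc Sᵀ Yᵀ Z, hZ]
        simp
      rw [hx, trace_add]
      linarith [trace_transpose_mul_self_nonneg (Y * S)]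
    have h5 := (abs_le.mp (abs_trace_transpose_mul_mul_le R Z)).1
    rw [← h𝓡] at h5
    have h𝓡0 : 0 ≤ 𝓡 := h𝓡 ▸ Real.sqrt_nonneg _
    have hξ0 := trace_transpose_mul_self_nonneg ξ
    have hp1 : (1 : ℝ) ≤ p := by exact_mod_cast hp
    have h6 : 𝓡 * (Zᵀ * Z).trace ≤ p * (𝓡 * (ξᵀ * ξ).trace) :=
      (mul_le_mul_of_nonneg_left h4 h𝓡0).trans
        (le_mul_of_one_le_left (mul_nonneg h𝓡0 hξ0) hp1)
    have h7 := mul_le_mul_of_nonneg_left h2 hl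
    rw [h3]
    linarith
  refine ⟨key, fun hgap S Z ξ hS hZ hξ hne => ?_⟩
  have hpos : 0 < (ξᵀ * ξ).trace := by
    refine (trace_transpose_mul_self_nonneg ξ).lt_of_ne' fun h => hne ?_
    rwa [← conjTranspose_eq_transpose_of_trivial, trace_conjTranspose_mul_self_eq_zero_iff] at h
  refine lt_of_lt_of_le (mul_pos ?_ hpos) (key S Z ξ hS hZ hξ)
  linarith
end

section
/- Let A, M ∈ ℝ^{n×n} be symmetric matrices. Then for all matrices Y, ξ, η ∈ ℝ^{n×p}, the bilinear form B(ξ, η) = tr(Yᵀ (A (Y ξᵀ + ξ Yᵀ) M + M (Y ξᵀ + ξ Yᵀ) A) η) is symmetric: tr(Yᵀ (A (Y ξᵀ + ξ Yᵀ) M + M (Y ξᵀ + ξ Yᵀ) A) η) = tr(Yᵀ (A (Y ηᵀ + η Yᵀ) M + M (Y ηᵀ + η Yᵀ) A) ξ). -/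
open Matrix

/-- For symmetric `A` and `M`, the bilinear form `tr((Yᵀ A Y)(ξᵀ M η))` is symmetric in `ξ`, `η`. -/
theorem trace_transpose_mul_isSymm_mul_swap
    {m k R : Type*} [Fintype m] [Fintype k] [CommRing R] {A M : Matrix m m R}
    (hA : A.IsSymm) (hM : M.IsSymm) (Y ξ η : Matrix m k R) :
    ((Yᵀ * A * Y) * (ξᵀ * M * η)).trace = ((Yᵀ * A * Y) * (ηᵀ * M * ξ)).trace := by
  rw [← trace_transpose, transpose_mul, trace_mul_comm]
  simp only [transpose_mul, transpose_transpose, hA.eq, hM.eq, Matrix.mul_assoc]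

/-- For symmetric `A, M ∈ ℝ^{n×n}` and all `Y, ξ, η ∈ ℝ^{n×p}`, the bilinear form
`B(ξ, η) = tr(Yᵀ (A (Yξᵀ + ξYᵀ) M + M (Yξᵀ + ξYᵀ) A) η)` is symmetric. -/
theorem preconditioner_bilinear_form_symmetric
    {n p : ℕ} (A M : Matrix (Fin n) (Fin n) ℝ)
    (hA : A.IsSymm) (hM : M.IsSymm)
    (Y ξ η : Matrix (Fin n) (Fin p) ℝ) :
    (Yᵀ * (A * (Y * ξᵀ + ξ * Yᵀ) * M + M * (Y * ξᵀ + ξ * Yᵀ) * A) * η).trace =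
      (Yᵀ * (A * (Y * ηᵀ + η * Yᵀ) * M + M * (Y * ηᵀ + η * Yᵀ) * A) * ξ).trace := by
  have hAM := trace_transpose_mul_isSymm_mul_swap hA hM Y ξ η
  have hMA := trace_transpose_mul_isSymm_mul_swap hM hA Y ξ η
  have hξη := trace_mul_comm (Yᵀ * A * ξ) (Yᵀ * M * η)
  have hηξ := trace_mul_comm (Yᵀ * M * ξ) (Yᵀ * A * η)
  simp only [Matrix.mul_add, Matrix.add_mul, trace_add, Matrix.mul_assoc] at *
  linarith
end
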